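/- arXiv:2512.23478 — 4 statements merged into one kernel-verified Lean document; each statement's English description precedes it below -/
import Mathlib

section
/- Let χ ∈ h be regular. Then the Gaudin Hamiltonians pairwise commute in t_Φ: for all h₁, h₂ ∈ h one has [H(h₁,χ), H(h₂,χ)] = 0. -/
open FreeLieAlgebra

noncomputable section

/-- The data of a reduced finite root system `Φ` spanning the dual of `H`,
together with a chosen system of positive roots `Φplus`. -/
structure RootSystemData (H : Type) [AddCommGroup H] [Module ℂ H] : Type where
  Φ : Set (Module.Dual ℂ H)
  finite : Φ.Finite
  zero_not_mem : (0 : Module.Dual ℂ H) ∉ Φ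
  spans : Submodule.span ℂ Φ = ⊤
  neg_mem : ∀ α ∈ Φ, -α ∈ Φ
  reduced : ∀ α ∈ Φ, ∀ c : ℂ, c • α ∈ Φ → c = 1 ∨ c = -1
  coroot_exists : ∀ α ∈ Φ, ∃ hα : H, α hα = 2 ∧
      ∀ β ∈ Φ, (β - β hα • α ∈ Φ ∧ ∃ m : ℤ, β hα = (m : ℂ))
  Φplus : Set (Module.Dual ℂ H)
  plus_subset : Φplus ⊆ Φ
  plus_union : Φ = Φplus ∪ {α | -α ∈ Φplus}
  plus_disjoint : Disjoint Φplus {α | -α ∈ Φplus}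
  plus_closed : ∀ α ∈ Φplus, ∀ β ∈ Φplus, α + β ∈ Φ → α + β ∈ Φplus

namespace RootSystemData

variable {H : Type} [AddCommGroup H] [Module ℂ H] (D : RootSystemData H)

open Classical in
/-- The generator `t_α` in the free Lie algebra on the set `Φ` (junk value `0` for `α ∉ Φ`). -/
def gen (α : Module.Dual ℂ H) : FreeLieAlgebra ℂ ↥D.Φ :=
  if h : α ∈ D.Φ then FreeLieAlgebra.of ℂ (⟨α, h⟩ : ↥D.Φ) else 0

/-- The defining relations of the holonomy Lie algebra `t_Φ`: `t_{-α} = t_α`, and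
`[t_α, ∑_{β ∈ Ψ⁺} t_β] = 0` whenever `Ψ = U ∩ Φ` for a 2-dimensional subspace `U ⊆ h*`
spanned by a subset of `Φ`, `α ∈ Ψ` and `Ψ⁺ = Ψ ∩ Φ⁺`. -/
def holRel : Set (FreeLieAlgebra ℂ ↥D.Φ) :=
  {x | (∃ α ∈ D.Φ, x = D.gen α - D.gen (-α)) ∨
    ∃ U : Submodule ℂ (Module.Dual ℂ H), Module.finrank ℂ U = 2 ∧
      (∃ s ⊆ D.Φ, U = Submodule.span ℂ s) ∧
      ∃ α ∈ D.Φ ∩ (U : Set (Module.Dual ℂ H)),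
        x = ⁅D.gen α, ∑ᶠ β ∈ D.Φplus ∩ (U : Set (Module.Dual ℂ H)), D.gen β⁆}

/-- The Lie ideal generated by the defining relations. -/
def holIdeal : LieIdeal ℂ (FreeLieAlgebra ℂ ↥D.Φ) :=
  LieSubmodule.lieSpan ℂ (FreeLieAlgebra ℂ ↥D.Φ) D.holRel

/-- The holonomy Lie algebra `t_Φ`, presented by the generators `t_α`, `α ∈ Φ`,
and the holonomy relations. -/
abbrev Hol := FreeLieAlgebra ℂ ↥D.Φ ⧸ D.holIdeal

/-- The image of the generator `t_α` in `t_Φ`. -/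
def T (α : Module.Dual ℂ H) : D.Hol := LieSubmodule.Quotient.mk' D.holIdeal (D.gen α)

/-- `χ ∈ h` is regular if no root vanishes on it. -/
def IsRegular (χ : H) : Prop := ∀ α ∈ D.Φ, α χ ≠ 0

/-- The Gaudin Hamiltonian `H(h,χ) = ∑_{α ∈ Φ⁺} (α(h)/α(χ)) t_α ∈ t_Φ`. -/
def gaudin (χ h : H) : D.Hol := ∑ᶠ α ∈ D.Φplus, (α h / α χ) • D.T α

end RootSystemData

namespace RootSystemData

section

variable {H : Type} [AddCommGroup H] [Module ℂ H] (D : RootSystemData H)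

/-- The positive roots, as a finset. -/
def posRoots : Finset (Module.Dual ℂ H) := (D.finite.subset D.plus_subset).toFinset

lemma mem_posRoots {α : Module.Dual ℂ H} : α ∈ D.posRoots ↔ α ∈ D.Φplus := by
  simp [posRoots]

lemma gaudin_eq_sum (χ h : H) :
    D.gaudin χ h = ∑ α ∈ D.posRoots, (α h / α χ) • D.T α :=
  finsum_mem_eq_finite_toFinset_sum _ _

lemma linearIndependent_of_mem_plus {α β : Module.Dual ℂ H} (hα : α ∈ D.Φplus)
    (hβ : β ∈ D.Φplus) (hne : α ≠ β) : LinearIndependent ℂ ![α, β] := by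
  have hα0 : α ≠ 0 := fun h => D.zero_not_mem (h ▸ D.plus_subset hα)
  rw [LinearIndependent.pair_iff' hα0]
  rintro c rfl
  rcases D.reduced α (D.plus_subset hα) c (D.plus_subset hβ) with rfl | rfl
  · simp at hne
  · exact Set.disjoint_left.mp D.plus_disjoint hα (by simpa using hβ)

open Classical in
/-- The sum of the generators attached to the positive roots in a rank two subsystem commutes
with each of these generators. -/
lemma lie_T_sum_eq_zero {U : Submodule ℂ (Module.Dual ℂ H)} (hU : Module.finrank ℂ U = 2)
    (hs : ∃ s ⊆ D.Φ, U = Submodule.span ℂ s) {α : Module.Dual ℂ H} (hα : α ∈ D.Φ)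
    (hαU : α ∈ U) : ⁅D.T α, ∑ β ∈ D.posRoots with β ∈ U, D.T β⁆ = 0 := by
  have hsum : ∑ᶠ β ∈ D.Φplus ∩ (U : Set (Module.Dual ℂ H)), D.gen β
      = ∑ β ∈ D.posRoots with β ∈ U, D.gen β := by
    rw [← finsum_mem_coe_finset]
    congr! 4
    simp only [Finset.coe_filter, mem_posRoots]
    rfl
  have hmem : ⁅D.gen α, ∑ β ∈ D.posRoots with β ∈ U, D.gen β⁆ ∈ D.holIdeal :=
    LieSubmodule.subset_lieSpan (Or.inr ⟨U, hU, hs, α, ⟨hα, hαU⟩, by rw [hsum]⟩)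
  have hT : ∑ β ∈ D.posRoots with β ∈ U, D.T β
      = LieSubmodule.Quotient.mk' D.holIdeal (∑ β ∈ D.posRoots with β ∈ U, D.gen β) := by
    rw [map_sum]
    rfl
  rw [hT]
  exact Eq.trans rfl
    ((LieSubmodule.Quotient.mk_eq_zero' (N := D.holIdeal)).mpr hmem)

/-- Three vectors become linearly dependent as functionals on a plane of linear forms. -/
lemma exists_relation_of_finrank_eq_two {U : Submodule ℂ (Module.Dual ℂ H)}
    (hU : Module.finrank ℂ U = 2) (x y z : H) :
    ∃ v : Fin 3 → ℂ, v ≠ 0 ∧ ∀ γ ∈ U, v 0 * γ x + v 1 * γ y + v 2 * γ z = 0 := by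
  have : Module.Finite ℂ U := Module.finite_of_finrank_pos (by omega)
  let e : H →ₗ[ℂ] Module.Dual ℂ U := U.subtype.dualMap ∘ₗ Module.Dual.eval ℂ H
  let f : (Fin 3 → ℂ) →ₗ[ℂ] Module.Dual ℂ U := Fintype.linearCombination ℂ ![e x, e y, e z]
  have hker : LinearMap.ker f ≠ ⊥ := LinearMap.ker_ne_bot_of_finrank_lt (by
    rw [Subspace.dual_finrank_eq, hU]; simp)
  obtain ⟨v, hv, hv0⟩ := (Submodule.ne_bot_iff _).mp hker
  refine ⟨v, hv0, fun γ hγ => ?_⟩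
  have h := LinearMap.congr_fun (LinearMap.mem_ker.mp hv) ⟨γ, hγ⟩
  simpa [f, e, Fintype.linearCombination_apply, Fin.sum_univ_three] using h

open Classical in
/-- The partial Gaudin Hamiltonians attached to a rank two subsystem commute. -/
lemma lie_sum_rank_two_eq_zero {χ : H} (hχ : D.IsRegular χ) (h₁ h₂ : H)
    {U : Submodule ℂ (Module.Dual ℂ H)} (hU : Module.finrank ℂ U = 2)
    (hs : ∃ s ⊆ D.Φ, U = Submodule.span ℂ s) {δ : Module.Dual ℂ H} (hδ : δ ∈ D.Φ)
    (hδU : δ ∈ U) :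
    ⁅∑ α ∈ D.posRoots with α ∈ U, (α h₁ / α χ) • D.T α,
      ∑ α ∈ D.posRoots with α ∈ U, (α h₂ / α χ) • D.T α⁆ = 0 := by
  obtain ⟨v, hv0, hv⟩ := exists_relation_of_finrank_eq_two hU h₁ h₂ χ
  set S := ∑ α ∈ D.posRoots with α ∈ U, D.T α with hS
  set X := ∑ α ∈ D.posRoots with α ∈ U, (α h₁ / α χ) • D.T α with hX
  set Y := ∑ α ∈ D.posRoots with α ∈ U, (α h₂ / α χ) • D.T α with hY
  have hcomm (h : H) : ⁅∑ α ∈ D.posRoots with α ∈ U, (α h / α χ) • D.T α, S⁆ = 0 := by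
    rw [sum_lie]
    refine Finset.sum_eq_zero fun α hα => ?_
    rw [Finset.mem_filter, mem_posRoots] at hα
    rw [smul_lie, hS, D.lie_T_sum_eq_zero hU hs (D.plus_subset hα.1) hα.2, smul_zero]
  have hXS : ⁅X, S⁆ = 0 := hcomm h₁
  have hYS : ⁅Y, S⁆ = 0 := hcomm h₂
  have hSY : ⁅S, Y⁆ = 0 := by rw [← lie_skew, hYS, neg_zero]
  have hrel : v 0 • X + v 1 • Y + v 2 • S = 0 := by
    rw [hX, hY, hS, Finset.smul_sum, Finset.smul_sum, Finset.smul_sum,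
      ← Finset.sum_add_distrib, ← Finset.sum_add_distrib]
    refine Finset.sum_eq_zero fun α hα => ?_
    rw [Finset.mem_filter, mem_posRoots] at hα
    have hαχ := hχ α (D.plus_subset hα.1)
    have hc : v 0 * (α h₁ / α χ) + v 1 * (α h₂ / α χ) + v 2 = 0 := by
      have := hv α hα.2
      field_simp
      linear_combination this
    rw [smul_smul, smul_smul, ← add_smul, ← add_smul, hc, zero_smul]
  have h0 : v 0 • ⁅X, Y⁆ = 0 := by
    have := congrArg (fun Z => ⁅Z, Y⁆) hrel
    simpa [hSY] using this
  have h1 : v 1 • ⁅X, Y⁆ = 0 := by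
    have := congrArg (fun Z => ⁅X, Z⁆) hrel
    simpa [hXS] using this
  by_contra hne
  have hv0' : v 0 = 0 := (smul_eq_zero.mp h0).resolve_right hne
  have hv1' : v 1 = 0 := (smul_eq_zero.mp h1).resolve_right hne
  have hv2' : v 2 = 0 := by simpa [hv0', hv1', hχ δ hδ] using hv δ hδU
  exact hv0 (by ext i; fin_cases i <;> assumption)

end

end RootSystemData

/-- For regular `χ`, the Gaudin Hamiltonians pairwise commute in `t_Φ`. -/
theorem gaudin_hamiltonians_commute {H : Type} [AddCommGroup H] [Module ℂ H]
    [FiniteDimensional ℂ H] (D : RootSystemData H)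
    (χ : H) (hχ : D.IsRegular χ) (h₁ h₂ : H) :
    ⁅D.gaudin χ h₁, D.gaudin χ h₂⁆ = 0 := by
  classical
  rw [D.gaudin_eq_sum, D.gaudin_eq_sum, sum_lie_sum, ← Finset.sum_product',
    ← Finset.sum_fiberwise_of_maps_to
      (fun p hp => Finset.mem_image_of_mem
        (fun p : Module.Dual ℂ H × Module.Dual ℂ H => Submodule.span ℂ {p.1, p.2}) hp)]
  refine Finset.sum_eq_zero fun U hUmem => ?_
  obtain ⟨⟨α, β⟩, hp, hspan⟩ := Finset.mem_image.mp hUmem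
  simp only [Finset.mem_product, D.mem_posRoots] at hp hspan
  by_cases hU : Module.finrank ℂ U = 2
  · have hs : ∃ s ⊆ D.Φ, U = Submodule.span ℂ s :=
      ⟨{α, β}, Set.pair_subset (D.plus_subset hp.1) (D.plus_subset hp.2), hspan.symm⟩
    have hαU : α ∈ U := hspan ▸ Submodule.subset_span (by simp)
    rw [← D.lie_sum_rank_two_eq_zero hχ h₁ h₂ hU hs (D.plus_subset hp.1) hαU,
      sum_lie_sum, ← Finset.sum_product']
    refine Finset.sum_subset (fun p hp => ?_) (fun p hp hp' => ?_)
    · simp only [Finset.mem_filter, Finset.mem_product] at hp ⊢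
      exact ⟨⟨hp.1.1, hp.2 ▸ Submodule.subset_span (by simp)⟩,
        ⟨hp.1.2, hp.2 ▸ Submodule.subset_span (by simp)⟩⟩
    · simp only [Finset.mem_filter, Finset.mem_product, not_and] at hp hp'
      by_cases hne : p.1 = p.2
      · simp [hne]
      · have hli := D.linearIndependent_of_mem_plus (D.mem_posRoots.mp hp.1.1)
          (D.mem_posRoots.mp hp.2.1) hne
        have hfr := finrank_span_eq_card hli
        rw [Matrix.range_cons_cons_empty, Fintype.card_fin] at hfr
        refine absurd ?_ (hp' ⟨hp.1.1, hp.2.1⟩)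
        have : Module.Finite ℂ U := Module.finite_of_finrank_pos (by omega)
        exact Submodule.eq_of_le_of_finrank_eq
          (Submodule.span_le.mpr (Set.pair_subset hp.1.2 hp.2.2)) (hfr.trans hU.symm)
  · refine Finset.sum_eq_zero fun p hp => ?_
    simp only [Finset.mem_filter, Finset.mem_product, D.mem_posRoots] at hp
    by_cases hne : p.1 = p.2
    · simp [hne]
    · have hfr := finrank_span_eq_card (D.linearIndependent_of_mem_plus hp.1.1 hp.1.2 hne)
      rw [Matrix.range_cons_cons_empty, Fintype.card_fin, hp.2] at hfr
      exact absurd hfr hU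

end
end

section
/- Assume Φ is irreducible, i.e. there is no direct sum decomposition h* = V₁ ⊕ V₂ with V₁ ≠ 0, V₂ ≠ 0 and Φ ⊆ V₁ ∪ V₂. Then for regular χ₁, χ₂ ∈ h, G(χ₁) = G(χ₂) if and only if χ₂ = c·χ₁ for some c ∈ ℂ^×; in particular, the map sending the line ℂχ to G(χ) is injective on regular lines. -/
open FreeLieAlgebra

noncomputable section

namespace RootSystemData

variable {H : Type} [AddCommGroup H] [Module ℂ H] (D : RootSystemData H)

attribute [local instance] LieRing.ofAssociativeRing

open Classical in
/-- The character of the free Lie algebra taking the value `1` on the generators `t_α`, `t_{-α}`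
and `0` on all others. -/
def freeCoord (α : Module.Dual ℂ H) : FreeLieAlgebra ℂ ↥D.Φ →ₗ⁅ℂ⁆ ℂ :=
  FreeLieAlgebra.lift ℂ fun β : ↥D.Φ => if β.1 = α ∨ β.1 = -α then (1 : ℂ) else 0

open Classical in
theorem freeCoord_gen (α : Module.Dual ℂ H) {β : Module.Dual ℂ H} (hβ : β ∈ D.Φ) :
    D.freeCoord α (D.gen β) = if β = α ∨ β = -α then 1 else 0 := by
  simp [freeCoord, gen, hβ]

theorem freeCoord_eq_zero_of_mem (α : Module.Dual ℂ H) {x : FreeLieAlgebra ℂ ↥D.Φ}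
    (hx : x ∈ D.holIdeal) : D.freeCoord α x = 0 := by
  have hle : D.holIdeal ≤ (D.freeCoord α).ker := by
    refine LieSubmodule.lieSpan_le.2 ?_
    rintro x (⟨β, hβ, rfl⟩ | ⟨U, -, -, β, -, rfl⟩) <;>
      rw [SetLike.mem_coe, LieHom.mem_ker]
    · rw [map_sub, freeCoord_gen D α hβ, freeCoord_gen D α (D.neg_mem β hβ), sub_eq_zero]
      have : (-β = α ∨ -β = -α) ↔ (β = α ∨ β = -α) := by
        rw [neg_inj, neg_eq_iff_eq_neg, or_comm]
      by_cases h : β = α ∨ β = -α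
      · rw [if_pos h, if_pos (this.2 h)]
      · rw [if_neg h, if_neg (mt this.1 h)]
    · rw [LieHom.map_lie, LieRing.of_associative_ring_bracket, mul_comm, sub_self]
  exact LieHom.mem_ker.1 (hle hx)

/-- The linear functional on `t_Φ` reading off the coefficient of `t_α` in degree one. -/
def coord (α : Module.Dual ℂ H) : D.Hol →ₗ[ℂ] ℂ :=
  D.holIdeal.toSubmodule.liftQ (D.freeCoord α : FreeLieAlgebra ℂ ↥D.Φ →ₗ[ℂ] ℂ)
    fun _ hx => D.freeCoord_eq_zero_of_mem α hx

open Classical in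
theorem coord_T {α β : Module.Dual ℂ H} (hα : α ∈ D.Φplus) (hβ : β ∈ D.Φplus) :
    D.coord α (D.T β) = if β = α then 1 else 0 := by
  have h1 : D.coord α (D.T β) = D.freeCoord α (D.gen β) := rfl
  have h2 : β ≠ -α := fun h =>
    Set.disjoint_left.1 D.plus_disjoint hβ (by simpa [h] using hα)
  rw [h1, freeCoord_gen D α (D.plus_subset hβ)]
  simp [h2]

theorem coord_gaudin {α : Module.Dual ℂ H} (hα : α ∈ D.Φplus) (χ h : H) :
    D.coord α (D.gaudin χ h) = α h / α χ := by
  classical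
  have hfin : D.Φplus.Finite := D.finite.subset D.plus_subset
  rw [gaudin, finsum_mem_eq_finite_toFinset_sum _ hfin, map_sum,
    Finset.sum_eq_single_of_mem α (hfin.mem_toFinset.2 hα)]
  · simp [coord_T D hα hα]
  · intro β hβ hne
    simp [coord_T D hα (hfin.mem_toFinset.1 hβ), hne]

theorem exists_coord_eq_of_mem_span {χ : H} {x : D.Hol}
    (hx : x ∈ Submodule.span ℂ (Set.range (D.gaudin χ))) :
    ∃ h : H, ∀ α ∈ D.Φplus, D.coord α x = α h / α χ := by
  induction hx using Submodule.span_induction with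
  | mem x hx =>
    obtain ⟨h, rfl⟩ := hx
    exact ⟨h, fun α hα => D.coord_gaudin hα χ h⟩
  | zero => exact ⟨0, by simp⟩
  | add x y _ _ hx hy =>
    obtain ⟨h, hh⟩ := hx
    obtain ⟨k, hk⟩ := hy
    exact ⟨h + k, fun α hα => by rw [map_add, hh α hα, hk α hα, map_add, add_div]⟩
  | smul c x _ hx =>
    obtain ⟨h, hh⟩ := hx
    exact ⟨c • h, fun α hα => by
      rw [map_smul, hh α hα, map_smul, smul_eq_mul, smul_eq_mul, mul_div_assoc]⟩

theorem gaudin_smul_left (c : ℂ) (χ h : H) : D.gaudin (c • χ) h = D.gaudin χ (c⁻¹ • h) := by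
  refine finsum_mem_congr rfl fun α _ => ?_
  simp only [map_smul, smul_eq_mul]
  congr 1
  ring

theorem eq_of_forall_root {x y : H} (h : ∀ α ∈ D.Φ, α x = α y) : x = y := by
  rw [← sub_eq_zero, ← Module.forall_dual_apply_eq_zero_iff ℂ]
  intro f
  rw [map_sub, sub_eq_zero]
  have hf : f ∈ Submodule.span ℂ D.Φ := D.spans ▸ Submodule.mem_top
  induction hf using Submodule.span_induction with
  | mem f hf => exact h f hf
  | zero => rfl
  | add f g _ _ hf hg => simp [hf, hg]
  | smul c f _ hf => simp [hf]

/-- If the Gaudin subspace at `χ₁` is contained in that at `χ₂`, some endomorphism of `h` scales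
every root `α` by `α(χ₂)/α(χ₁)`. -/
theorem exists_end_of_span_le {χ₁ χ₂ : H} (hχ₂ : D.IsRegular χ₂)
    (hle : Submodule.span ℂ (Set.range (D.gaudin χ₁)) ≤
      Submodule.span ℂ (Set.range (D.gaudin χ₂))) :
    ∃ A : H →ₗ[ℂ] H, ∀ α ∈ D.Φ, ∀ h, α (A h) = α χ₂ / α χ₁ * α h := by
  have key : ∀ h, ∃ k, ∀ α ∈ D.Φ, α k = α χ₂ / α χ₁ * α h := by
    intro h
    obtain ⟨k, hk⟩ := D.exists_coord_eq_of_mem_span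
      (hle (Submodule.subset_span (Set.mem_range_self h)))
    have hplus : ∀ α ∈ D.Φplus, α k = α χ₂ / α χ₁ * α h := by
      intro α hα
      have h2 := hχ₂ α (D.plus_subset hα)
      have e := hk α hα
      rw [D.coord_gaudin hα, eq_div_iff h2] at e
      rw [← e]
      ring
    refine ⟨k, fun α hα => ?_⟩
    rw [D.plus_union] at hα
    rcases hα with hα | hα
    · exact hplus α hα
    · simpa using hplus (-α) hα
  choose f hf using key
  refine ⟨{ toFun := f, map_add' := fun x y => ?_, map_smul' := fun c x => ?_ }, fun α hα h =>
    hf h α hα⟩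
  · refine D.eq_of_forall_root fun α hα => ?_
    rw [map_add, hf _ α hα, hf _ α hα, hf _ α hα, map_add, mul_add]
  · refine D.eq_of_forall_root fun α hα => ?_
    rw [RingHom.id_apply, map_smul, hf _ α hα, hf _ α hα, map_smul, smul_eq_mul, smul_eq_mul,
      mul_left_comm]

/-- For irreducible `Φ`, an endomorphism of `h*` having every root as an eigenvector has a single
eigenvalue on the roots. -/
theorem eigenvalue_eq_of_irreducible
    (hirr : ¬ ∃ V₁ V₂ : Submodule ℂ (Module.Dual ℂ H), V₁ ≠ ⊥ ∧ V₂ ≠ ⊥ ∧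
      V₁ ⊓ V₂ = ⊥ ∧ V₁ ⊔ V₂ = ⊤ ∧
      D.Φ ⊆ (V₁ : Set (Module.Dual ℂ H)) ∪ (V₂ : Set (Module.Dual ℂ H)))
    (B : Module.End ℂ (Module.Dual ℂ H)) (c : Module.Dual ℂ H → ℂ)
    (hB : ∀ α ∈ D.Φ, B α = c α • α) {α β : Module.Dual ℂ H} (hα : α ∈ D.Φ) (hβ : β ∈ D.Φ) :
    c β = c α := by
  by_contra hne
  have hmem : ∀ γ ∈ D.Φ, γ ∈ B.eigenspace (c γ) := fun γ hγ =>
    Module.End.mem_eigenspace_iff.2 (hB γ hγ)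
  have hmem₂ : ∀ γ ∈ D.Φ, c γ ≠ c α → γ ∈ ⨆ ν, ⨆ (_ : ν ≠ c α), B.eigenspace ν :=
    fun γ hγ h => Submodule.mem_iSup_of_mem (c γ) (Submodule.mem_iSup_of_mem h (hmem γ hγ))
  have hsub : D.Φ ⊆ (B.eigenspace (c α) : Set (Module.Dual ℂ H)) ∪
      ((⨆ ν, ⨆ (_ : ν ≠ c α), B.eigenspace ν : Submodule ℂ (Module.Dual ℂ H)) :
        Set (Module.Dual ℂ H)) := by
    intro γ hγ
    by_cases h : c γ = c α
    · exact Or.inl (h ▸ hmem γ hγ)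
    · exact Or.inr (hmem₂ γ hγ h)
  refine hirr ⟨B.eigenspace (c α), ⨆ ν, ⨆ (_ : ν ≠ c α), B.eigenspace ν, ?_, ?_, ?_, ?_, hsub⟩
  · exact (Submodule.ne_bot_iff _).2 ⟨α, hmem α hα, fun h => D.zero_not_mem (h ▸ hα)⟩
  · exact (Submodule.ne_bot_iff _).2 ⟨β, hmem₂ β hβ hne, fun h => D.zero_not_mem (h ▸ hβ)⟩
  · exact disjoint_iff.1 (B.eigenspaces_iSupIndep (c α))
  · rw [eq_top_iff, ← D.spans, Submodule.span_le]
    refine hsub.trans (Set.union_subset ?_ ?_)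
    · exact SetLike.coe_subset_coe.2 le_sup_left
    · exact SetLike.coe_subset_coe.2 le_sup_right

end RootSystemData

/-- Assume `Φ` is irreducible: there is no direct sum decomposition `h* = V₁ ⊕ V₂` with
`V₁ ≠ 0`, `V₂ ≠ 0` and `Φ ⊆ V₁ ∪ V₂`. Then for regular `χ₁, χ₂ ∈ h` we have
`G(χ₁) = G(χ₂)` if and only if `χ₂ = c • χ₁` for some nonzero scalar `c`; in particular the
map sending the line `ℂχ` to `G(χ)` is injective on regular lines. -/
theorem gaudin_subspace_injective_on_lines {H : Type} [AddCommGroup H] [Module ℂ H]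
    [FiniteDimensional ℂ H] (D : RootSystemData H)
    (hirr : ¬ ∃ V₁ V₂ : Submodule ℂ (Module.Dual ℂ H), V₁ ≠ ⊥ ∧ V₂ ≠ ⊥ ∧
      V₁ ⊓ V₂ = ⊥ ∧ V₁ ⊔ V₂ = ⊤ ∧
      D.Φ ⊆ (V₁ : Set (Module.Dual ℂ H)) ∪ (V₂ : Set (Module.Dual ℂ H)))
    (χ₁ χ₂ : H) (hχ₁ : D.IsRegular χ₁) (hχ₂ : D.IsRegular χ₂) :
    Submodule.span ℂ (Set.range (D.gaudin χ₁)) = Submodule.span ℂ (Set.range (D.gaudin χ₂)) ↔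
      ∃ c : ℂ, c ≠ 0 ∧ χ₂ = c • χ₁ := by
  constructor
  · intro hG
    obtain ⟨A, hA⟩ := D.exists_end_of_span_le hχ₂ hG.le
    have hB : ∀ α ∈ D.Φ, A.dualMap α = (α χ₂ / α χ₁) • α := fun α hα =>
      LinearMap.ext fun h => hA α hα h
    rcases D.Φ.eq_empty_or_nonempty with hΦ | ⟨α, hα⟩
    · exact ⟨1, one_ne_zero, D.eq_of_forall_root (by simp [hΦ])⟩
    · refine ⟨α χ₂ / α χ₁, div_ne_zero (hχ₂ α hα) (hχ₁ α hα), D.eq_of_forall_root fun β hβ => ?_⟩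
      rw [map_smul, smul_eq_mul,
        ← D.eigenvalue_eq_of_irreducible hirr _ (fun γ => γ χ₂ / γ χ₁) hB hα hβ,
        div_mul_cancel₀ _ (hχ₁ β hβ)]
  · rintro ⟨c, hc, rfl⟩
    congr 1
    ext x
    constructor
    · rintro ⟨h, rfl⟩
      exact ⟨c • h, by rw [D.gaudin_smul_left, inv_smul_smul₀ hc]⟩
    · rintro ⟨h, rfl⟩
      exact ⟨c⁻¹ • h, (D.gaudin_smul_left c χ₁ h).symm⟩

end
end

section
/- The assignment C ↦ Q(C) is injective on T^reg: if C₁, C₂ ∈ T^reg satisfy Q(C₁) = Q(C₂) as subspaces of t_Φ^trig, then C₁ = C₂. -/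
open FreeLieAlgebra

noncomputable section

namespace RootSystemData

variable {H : Type} [AddCommGroup H] [Module ℂ H] (D : RootSystemData H)

open Classical in
/-- The generator `t_α` in the free Lie algebra on `Φ ⊕ h` (junk value `0` for `α ∉ Φ`). -/
def tgen (α : Module.Dual ℂ H) : FreeLieAlgebra ℂ (↥D.Φ ⊕ H) :=
  if h : α ∈ D.Φ then FreeLieAlgebra.of ℂ (Sum.inl (⟨α, h⟩ : ↥D.Φ)) else 0

/-- The generator `τ(h)` in the free Lie algebra on `Φ ⊕ h`. -/
def ttau (v : H) : FreeLieAlgebra ℂ (↥D.Φ ⊕ H) := FreeLieAlgebra.of ℂ (Sum.inr v)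

/-- `δ(h) = τ(h) - (1/2) ∑_{β ∈ Φ⁺} β(h) t_β`. -/
def tdelta (v : H) : FreeLieAlgebra ℂ (↥D.Φ ⊕ H) :=
  D.ttau v - (2⁻¹ : ℂ) • ∑ᶠ β ∈ D.Φplus, β v • D.tgen β

/-- The defining relations of the trigonometric holonomy Lie algebra `t_Φ^trig`:
`t_{-α} = t_α`; `τ` is `ℂ`-linear; `[τ(h₁), τ(h₂)] = 0`; `[t_α, ∑_{β ∈ Ψ⁺} t_β] = 0` for
every closed rank-2 root subsystem `Ψ ⊆ Φ` and `α ∈ Ψ`; and `[t_α, δ(h)] = 0` whenever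
`α(h) = 0`. -/
def trigRel : Set (FreeLieAlgebra ℂ (↥D.Φ ⊕ H)) :=
  {x | (∃ α ∈ D.Φ, x = D.tgen α - D.tgen (-α)) ∨
    (∃ (c₁ c₂ : ℂ) (h₁ h₂ : H),
      x = D.ttau (c₁ • h₁ + c₂ • h₂) - c₁ • D.ttau h₁ - c₂ • D.ttau h₂) ∨
    (∃ h₁ h₂ : H, x = ⁅D.ttau h₁, D.ttau h₂⁆) ∨
    (∃ Ψ : Set (Module.Dual ℂ H), Ψ ⊆ D.Φ ∧ (∀ α ∈ Ψ, -α ∈ Ψ) ∧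
      Module.finrank ℂ (Submodule.span ℂ Ψ) = 2 ∧
      (∀ α ∈ Ψ, ∀ β ∈ Ψ, α + β ∈ D.Φ → α + β ∈ Ψ) ∧
      ∃ α ∈ Ψ, x = ⁅D.tgen α, ∑ᶠ β ∈ Ψ ∩ D.Φplus, D.tgen β⁆) ∨
    (∃ α ∈ D.Φ, ∃ v : H, α v = 0 ∧ x = ⁅D.tgen α, D.tdelta v⁆)}

/-- The Lie ideal generated by the trigonometric relations. -/
def trigIdeal : LieIdeal ℂ (FreeLieAlgebra ℂ (↥D.Φ ⊕ H)) :=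
  LieSubmodule.lieSpan ℂ (FreeLieAlgebra ℂ (↥D.Φ ⊕ H)) D.trigRel

/-- The trigonometric holonomy Lie algebra `t_Φ^trig`. -/
abbrev Trig := FreeLieAlgebra ℂ (↥D.Φ ⊕ H) ⧸ D.trigIdeal

/-- The image of the generator `t_α` in `t_Φ^trig`. -/
def TT (α : Module.Dual ℂ H) : D.Trig := LieSubmodule.Quotient.mk' D.trigIdeal (D.tgen α)

/-- The image of the generator `τ(h)` in `t_Φ^trig`. -/
def TTau (v : H) : D.Trig := LieSubmodule.Quotient.mk' D.trigIdeal (D.ttau v)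

/-- The image of `δ(h)` in `t_Φ^trig`. -/
def TDelta (v : H) : D.Trig := LieSubmodule.Quotient.mk' D.trigIdeal (D.tdelta v)

/-- The root lattice `R = ℤΦ ⊆ h*`. -/
def rootLattice : AddSubgroup (Module.Dual ℂ H) := AddSubgroup.closure D.Φ

/-- The torus `T = Hom_ℤ(R, ℂ^×)`. -/
abbrev Torus := ↥D.rootLattice →+ Additive ℂˣ

open Classical in
/-- The value `e^α(C) ∈ ℂ` of the character `e^α` at `C ∈ T` (junk value `1` for `α ∉ R`). -/
def toruseval (C : D.Torus) (α : Module.Dual ℂ H) : ℂ :=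
  if h : α ∈ D.rootLattice then ((Additive.toMul (C ⟨α, h⟩) : ℂˣ) : ℂ) else 1

/-- `C ∈ T` is regular if `e^α(C) ≠ 1` for all `α ∈ Φ`. -/
def IsRegularTorus (C : D.Torus) : Prop := ∀ α ∈ D.Φ, D.toruseval C α ≠ 1

/-- The Bethe Hamiltonian
`BH(C,h) = τ(h) - ∑_{α ∈ Φ⁺} (e^α(C) α(h)/(e^α(C) - 1)) t_α ∈ t_Φ^trig`. -/
def BH (C : D.Torus) (v : H) : D.Trig :=
  D.TTau v - ∑ᶠ α ∈ D.Φplus, (D.toruseval C α * α v / (D.toruseval C α - 1)) • D.TT α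

/-- The Bethe subspace `Q(C) = span{BH(C,h) : h ∈ h}`. -/
def BetheSubspace (C : D.Torus) : Submodule ℂ D.Trig :=
  Submodule.span ℂ (Set.range (D.BH C))

end RootSystemData

namespace RootSystemData

variable {H : Type} [AddCommGroup H] [Module ℂ H] (D : RootSystemData H)

attribute [local instance] LieRing.ofAssociativeRing

open Classical in
/-- The character of the free Lie algebra which is `1` on `t_{±α}`, `0` on the other `t_β`,
and `φ` on `τ`. -/
def freeCharacter (α : Module.Dual ℂ H) (φ : Module.Dual ℂ H) :
    FreeLieAlgebra ℂ (↥D.Φ ⊕ H) →ₗ⁅ℂ⁆ ℂ :=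
  FreeLieAlgebra.lift ℂ
    (Sum.elim (fun β => if (β : Module.Dual ℂ H) = α ∨ (β : Module.Dual ℂ H) = -α then 1 else 0) φ)

open Classical in
theorem freeCharacter_tgen (α φ : Module.Dual ℂ H) {β : Module.Dual ℂ H} (hβ : β ∈ D.Φ) :
    D.freeCharacter α φ (D.tgen β) = if β = α ∨ β = -α then 1 else 0 := by
  simp [freeCharacter, tgen, hβ, FreeLieAlgebra.lift_of_apply]

theorem freeCharacter_ttau (α φ : Module.Dual ℂ H) (v : H) :
    D.freeCharacter α φ (D.ttau v) = φ v := by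
  simp [freeCharacter, ttau, FreeLieAlgebra.lift_of_apply]

theorem freeCharacter_lie (α φ : Module.Dual ℂ H) (x y : FreeLieAlgebra ℂ (↥D.Φ ⊕ H)) :
    D.freeCharacter α φ ⁅x, y⁆ = 0 := by
  rw [LieHom.map_lie, Ring.lie_def, mul_comm, sub_self]

open Classical in
theorem trigIdeal_le_ker_freeCharacter (α φ : Module.Dual ℂ H) :
    D.trigIdeal ≤ (D.freeCharacter α φ).ker := by
  refine LieSubmodule.lieSpan_le.2 ?_
  rintro x (⟨β, hβ, rfl⟩ | ⟨c₁, c₂, h₁, h₂, rfl⟩ | ⟨h₁, h₂, rfl⟩ |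
    ⟨Ψ, -, -, -, -, β, -, rfl⟩ | ⟨β, -, v, -, rfl⟩)
  · have h : (-β = α ∨ -β = -α) ↔ (β = α ∨ β = -α) := by
      rw [neg_inj, neg_eq_iff_eq_neg, or_comm]
    rw [SetLike.mem_coe, LieHom.mem_ker, map_sub, D.freeCharacter_tgen α φ hβ,
      D.freeCharacter_tgen α φ (D.neg_mem β hβ), if_congr h rfl rfl, sub_self]
  · simp [LieHom.mem_ker, freeCharacter_ttau]
  all_goals exact D.freeCharacter_lie α φ _ _

/-- The linear functional on `t_Φ^trig` induced by `freeCharacter`. -/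
def trigFunctional (α φ : Module.Dual ℂ H) : D.Trig →ₗ[ℂ] ℂ :=
  D.trigIdeal.toSubmodule.liftQ (D.freeCharacter α φ).toLinearMap
    fun _ hx => D.trigIdeal_le_ker_freeCharacter α φ hx

open Classical in
theorem trigFunctional_TT (α φ : Module.Dual ℂ H) {β : Module.Dual ℂ H} (hβ : β ∈ D.Φ) :
    D.trigFunctional α φ (D.TT β) = if β = α ∨ β = -α then 1 else 0 :=
  D.freeCharacter_tgen α φ hβ

theorem trigFunctional_TTau (α φ : Module.Dual ℂ H) (v : H) :
    D.trigFunctional α φ (D.TTau v) = φ v :=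
  D.freeCharacter_ttau α φ v

theorem trigFunctional_BH {α : Module.Dual ℂ H} (hα : α ∈ D.Φplus) (φ : Module.Dual ℂ H)
    (C : D.Torus) (v : H) :
    D.trigFunctional α φ (D.BH C v) =
      φ v - D.toruseval C α * α v / (D.toruseval C α - 1) := by
  have hfin : D.Φplus.Finite := D.finite.subset D.plus_subset
  rw [BH, map_sub, trigFunctional_TTau, finsum_mem_eq_finite_toFinset_sum _ hfin, map_sum,
    Finset.sum_eq_single α]
  · simp [trigFunctional_TT, D.plus_subset hα]
  · intro β hβ hne
    have hβ' : β ∈ D.Φplus := by simpa using hβ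
    have hneg : β ≠ -α := by
      rintro rfl
      exact Set.disjoint_left.1 D.plus_disjoint hα hβ'
    simp [trigFunctional_TT, D.plus_subset hβ', hne, hneg]
  · simp [hα]

theorem toruseval_eq_of_betheSubspace_eq {C₁ C₂ : D.Torus} (hC₁ : D.IsRegularTorus C₁)
    (hC₂ : D.IsRegularTorus C₂) (hQ : D.BetheSubspace C₁ = D.BetheSubspace C₂)
    {α : Module.Dual ℂ H} (hα : α ∈ D.Φplus) : D.toruseval C₁ α = D.toruseval C₂ α := by
  have hαΦ := D.plus_subset hα
  obtain ⟨v, hv, -⟩ := D.coroot_exists α hαΦ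
  have h₁ := sub_ne_zero.2 (hC₁ α hαΦ)
  have h₂ := sub_ne_zero.2 (hC₂ α hαΦ)
  set φ : Module.Dual ℂ H := (D.toruseval C₂ α / (D.toruseval C₂ α - 1)) • α with hφ
  have hle : D.BetheSubspace C₂ ≤ (D.trigFunctional α φ).ker := by
    refine Submodule.span_le.2 ?_
    rintro _ ⟨w, rfl⟩
    simp only [SetLike.mem_coe, LinearMap.mem_ker, D.trigFunctional_BH hα, hφ,
      LinearMap.smul_apply, smul_eq_mul]
    ring
  have hker : D.trigFunctional α φ (D.BH C₁ v) = 0 :=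
    hle (hQ ▸ Submodule.subset_span ⟨v, rfl⟩)
  simp only [D.trigFunctional_BH hα, hφ, LinearMap.smul_apply, smul_eq_mul, hv] at hker
  field_simp at hker
  linear_combination hker / 2

theorem torus_ext {C₁ C₂ : D.Torus}
    (h : ∀ α ∈ D.Φplus, D.toruseval C₁ α = D.toruseval C₂ α) : C₁ = C₂ := by
  have hpos : ∀ α (hα : α ∈ D.rootLattice), α ∈ D.Φplus → C₁ ⟨α, hα⟩ = C₂ ⟨α, hα⟩ := by
    intro α hα hp
    have := h α hp
    simp only [toruseval, hα, dif_pos] at this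
    exact Additive.toMul.injective (Units.ext this)
  ext1 ⟨α, hα⟩
  induction hα using AddSubgroup.closure_induction with
  | mem α hαΦ =>
    have hα' : α ∈ D.rootLattice := AddSubgroup.subset_closure hαΦ
    rcases D.plus_union ▸ hαΦ with hp | hp
    · exact hpos α hα' hp
    · have := hpos (-α) (D.rootLattice.neg_mem hα') hp
      exact neg_injective ((map_neg C₁ ⟨α, hα'⟩).symm.trans (this.trans (map_neg C₂ ⟨α, hα'⟩)))
  | zero => exact (map_zero C₁).trans (map_zero C₂).symm
  | add x y hx hy ihx ihy =>
    exact (map_add C₁ ⟨x, hx⟩ ⟨y, hy⟩).trans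
      ((congrArg₂ (· + ·) ihx ihy).trans (map_add C₂ ⟨x, hx⟩ ⟨y, hy⟩).symm)
  | neg x hx ih =>
    exact (map_neg C₁ ⟨x, hx⟩).trans ((congrArg Neg.neg ih).trans (map_neg C₂ ⟨x, hx⟩).symm)

end RootSystemData

/-- The assignment `C ↦ Q(C)` is injective on `T^reg`: if `C₁, C₂ ∈ T^reg` have the same
Bethe subspace, then `C₁ = C₂`. -/
theorem bethe_subspace_injective {H : Type} [AddCommGroup H] [Module ℂ H]
    [FiniteDimensional ℂ H] (D : RootSystemData H)
    (C₁ C₂ : D.Torus) (hC₁ : D.IsRegularTorus C₁) (hC₂ : D.IsRegularTorus C₂)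
    (hQ : D.BetheSubspace C₁ = D.BetheSubspace C₂) :
    C₁ = C₂ :=
  D.torus_ext fun _ hα => D.toruseval_eq_of_betheSubspace_eq hC₁ hC₂ hQ hα

end
end

section
/- There is a Lie algebra homomorphism ψ : t_n^{trig} → t_A(n+1) (the latter on index set {0,1,…,n}) such that ψ(t_{ij}) = t_{ij} for 1 ≤ i < j ≤ n and ψ(τ(ω_k)) = −Σ_{l=1}^{k} Σ_{c=0}^{l−1} t_{cl} for k = 1,…,n. Moreover, ψ is injective on the span of the generators t_{ij} (1 ≤ i < j ≤ n) and τ(h) (h ∈ ℂ^n). -/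
open FreeLieAlgebra

noncomputable section

/-- The free Lie algebra on generators `t_{ij}`, `i, j ∈ {0, …, N-1}`. -/
abbrev FA (N : ℕ) := FreeLieAlgebra ℂ (Fin N × Fin N)

/-- The defining relations of the type-A holonomy Lie algebra `t_A(N)` on the index set
`{0, 1, …, N-1}`: symmetry `t_{ij} = t_{ji}` (with `t_{ii} = 0`, so that the actual
generators are `t_{ij}` for `i < j`), `[t_{ij}, t_{ik} + t_{jk}] = 0` for pairwise distinct
`i, j, k`, and `[t_{ij}, t_{kl}] = 0` for `{i,j} ∩ {k,l} = ∅`. -/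
def tARel (N : ℕ) : Set (FA N) :=
  {x | (∃ i j : Fin N, x = FreeLieAlgebra.of ℂ ((i, j) : Fin N × Fin N) -
          FreeLieAlgebra.of ℂ ((j, i) : Fin N × Fin N)) ∨
    (∃ i : Fin N, x = FreeLieAlgebra.of ℂ ((i, i) : Fin N × Fin N)) ∨
    (∃ i j k : Fin N, i ≠ j ∧ i ≠ k ∧ j ≠ k ∧
      x = ⁅FreeLieAlgebra.of ℂ ((i, j) : Fin N × Fin N),
           FreeLieAlgebra.of ℂ ((i, k) : Fin N × Fin N) +
           FreeLieAlgebra.of ℂ ((j, k) : Fin N × Fin N)⁆) ∨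
    (∃ i j k l : Fin N, i ≠ k ∧ i ≠ l ∧ j ≠ k ∧ j ≠ l ∧
      x = ⁅FreeLieAlgebra.of ℂ ((i, j) : Fin N × Fin N),
           FreeLieAlgebra.of ℂ ((k, l) : Fin N × Fin N)⁆)}

/-- The Lie ideal generated by the relations of `t_A(N)`. -/
def tAIdeal (N : ℕ) : LieIdeal ℂ (FA N) := LieSubmodule.lieSpan ℂ (FA N) (tARel N)

/-- The type-A holonomy Lie algebra `t_A(N)` (the holonomy Lie algebra of the root system
`A_{N-1}`), on the index set `{0, 1, …, N-1}`. -/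
abbrev tA (N : ℕ) := FA N ⧸ tAIdeal N

/-- The image of the generator `t_{ij}` in `t_A(N)`. -/
def tgenA (N : ℕ) (i j : Fin N) : tA N :=
  LieSubmodule.Quotient.mk' (tAIdeal N) (FreeLieAlgebra.of ℂ ((i, j) : Fin N × Fin N))

/-- `h = ℂⁿ`. -/
abbrev VA (n : ℕ) := Fin n → ℂ

/-- The coordinate functional `ε_i ∈ (ℂⁿ)*`. -/
def eps (n : ℕ) (i : Fin n) : Module.Dual ℂ (VA n) := LinearMap.proj i

/-- The type `A_{n-1}` root system `Φ = {ε_i - ε_j : i ≠ j} ⊆ (ℂⁿ)*` (gl_n realization). -/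
def PhiA (n : ℕ) : Set (Module.Dual ℂ (VA n)) :=
  {f | ∃ i j : Fin n, i ≠ j ∧ f = eps n i - eps n j}

/-- The positive roots `ε_i - ε_j`, `i < j`. -/
def PhiAplus (n : ℕ) : Set (Module.Dual ℂ (VA n)) :=
  {f | ∃ i j : Fin n, i < j ∧ f = eps n i - eps n j}

/-- The free Lie algebra on the generators `t_α` (`α ∈ Φ`) and `τ(h)` (`h ∈ ℂⁿ`). -/
abbrev FTrigA (n : ℕ) := FreeLieAlgebra ℂ (↥(PhiA n) ⊕ VA n)

open Classical in
/-- The generator `t_α` in the free Lie algebra (junk value `0` for `α ∉ Φ`). -/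
def tgA (n : ℕ) (f : Module.Dual ℂ (VA n)) : FTrigA n :=
  if h : f ∈ PhiA n then FreeLieAlgebra.of ℂ (Sum.inl (⟨f, h⟩ : ↥(PhiA n))) else 0

/-- The generator `τ(h)`. -/
def ttA (n : ℕ) (v : VA n) : FTrigA n := FreeLieAlgebra.of ℂ (Sum.inr v)

/-- `δ(h) = τ(h) - (1/2) ∑_{β ∈ Φ⁺} β(h) t_β`. -/
def tdA (n : ℕ) (v : VA n) : FTrigA n :=
  ttA n v - (2⁻¹ : ℂ) • ∑ᶠ f ∈ PhiAplus n, f v • tgA n f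

/-- The defining relations of the trigonometric holonomy Lie algebra `t_n^trig` of type
`A_{n-1}`: `t_{-α} = t_α`; `τ` is `ℂ`-linear; `[τ(h₁), τ(h₂)] = 0`;
`[t_α, ∑_{β ∈ Ψ⁺} t_β] = 0` for every closed rank-2 root subsystem `Ψ ⊆ Φ` and `α ∈ Ψ`; and
`[t_α, δ(h)] = 0` whenever `α(h) = 0`. -/
def trigARel (n : ℕ) : Set (FTrigA n) :=
  {x | (∃ α ∈ PhiA n, x = tgA n α - tgA n (-α)) ∨
    (∃ (c₁ c₂ : ℂ) (h₁ h₂ : VA n),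
      x = ttA n (c₁ • h₁ + c₂ • h₂) - c₁ • ttA n h₁ - c₂ • ttA n h₂) ∨
    (∃ h₁ h₂ : VA n, x = ⁅ttA n h₁, ttA n h₂⁆) ∨
    (∃ Ψ : Set (Module.Dual ℂ (VA n)), Ψ ⊆ PhiA n ∧ (∀ α ∈ Ψ, -α ∈ Ψ) ∧
      Module.finrank ℂ (Submodule.span ℂ Ψ) = 2 ∧
      (∀ α ∈ Ψ, ∀ β ∈ Ψ, α + β ∈ PhiA n → α + β ∈ Ψ) ∧
      ∃ α ∈ Ψ, x = ⁅tgA n α, ∑ᶠ β ∈ Ψ ∩ PhiAplus n, tgA n β⁆) ∨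
    (∃ α ∈ PhiA n, ∃ v : VA n, α v = 0 ∧ x = ⁅tgA n α, tdA n v⁆)}

/-- The Lie ideal generated by the trigonometric relations. -/
def trigAIdeal (n : ℕ) : LieIdeal ℂ (FTrigA n) :=
  LieSubmodule.lieSpan ℂ (FTrigA n) (trigARel n)

/-- The trigonometric holonomy Lie algebra `t_n^trig` of type `A_{n-1}`. -/
abbrev TrigA (n : ℕ) := FTrigA n ⧸ trigAIdeal n

/-- The image of `t_{ij} = t_{ε_i - ε_j}` in `t_n^trig`. -/
def TijA (n : ℕ) (i j : Fin n) : TrigA n :=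
  LieSubmodule.Quotient.mk' (trigAIdeal n) (tgA n (eps n i - eps n j))

/-- The image of `τ(h)` in `t_n^trig`. -/
def TauA (n : ℕ) (v : VA n) : TrigA n :=
  LieSubmodule.Quotient.mk' (trigAIdeal n) (ttA n v)

/-- `ω_k = e₁ + ⋯ + e_k ∈ ℂⁿ`. -/
def omegaA (n k : ℕ) : VA n := fun i => if (i : ℕ) < k then 1 else 0

/-- The element `∑_{l=1}^{k} ∑_{c=0}^{l-1} t_{cl} ∈ t_A(n+1)` (a partial sum of
Jucys–Murphy elements). -/
def JMsum (n k : ℕ) : tA (n + 1) :=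
  ∑ p ∈ Finset.univ.filter
      (fun p : Fin (n + 1) × Fin (n + 1) => p.1 < p.2 ∧ (p.2 : ℕ) ≤ k),
    tgenA (n + 1) p.1 p.2

/-- A homomorphism from a Lie algebra that kills a set of relations descends to the quotient by
the Lie ideal these relations generate. -/
theorem exists_lift_quotient_lieSpan {L L' : Type*} [LieRing L] [LieAlgebra ℂ L] [LieRing L']
    [LieAlgebra ℂ L'] {I : LieIdeal ℂ L} {s : Set L} (hI : I = LieSubmodule.lieSpan ℂ L s)
    (f : L →ₗ⁅ℂ⁆ L') (hf : ∀ x ∈ s, f x = 0) :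
    ∃ g : (L ⧸ I) →ₗ⁅ℂ⁆ L', ∀ x, g (LieSubmodule.Quotient.mk' I x) = f x := by
  have hle : I ≤ f.ker := hI ▸ LieSubmodule.lieSpan_le.2 fun x hx => LieHom.mem_ker.2 (hf x hx)
  refine ⟨{ Submodule.liftQ I.toSubmodule (f : L →ₗ[ℂ] L')
      (fun x hx => LieHom.mem_ker.1 (hle hx)) with
    map_lie' := ?_ }, fun x => rfl⟩
  intro x y
  induction x using Submodule.Quotient.induction_on
  induction y using Submodule.Quotient.induction_on
  exact LieHom.map_lie f _ _

section tA

variable {N : ℕ}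

theorem mk'_eq_zero_of_mem_tARel {x : FA N} (hx : x ∈ tARel N) :
    LieSubmodule.Quotient.mk' (tAIdeal N) x = 0 :=
  (LieSubmodule.Quotient.mk_eq_zero _).2 (LieSubmodule.subset_lieSpan hx)

theorem tgenA_comm (i j : Fin N) : tgenA N i j = tgenA N j i := by
  have h := mk'_eq_zero_of_mem_tARel (N := N) (Or.inl ⟨i, j, rfl⟩)
  rw [map_sub] at h
  exact sub_eq_zero.1 h

@[simp]
theorem tgenA_self (i : Fin N) : tgenA N i i = 0 :=
  mk'_eq_zero_of_mem_tARel (Or.inr (Or.inl ⟨i, rfl⟩))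

theorem lie_tgenA_add {i j k : Fin N} (hij : i ≠ j) (hik : i ≠ k) (hjk : j ≠ k) :
    ⁅tgenA N i j, tgenA N i k + tgenA N j k⁆ = 0 :=
  mk'_eq_zero_of_mem_tARel (Or.inr (Or.inr (Or.inl ⟨i, j, k, hij, hik, hjk, rfl⟩)))

theorem lie_tgenA_of_disjoint {i j k l : Fin N} (hik : i ≠ k) (hil : i ≠ l) (hjk : j ≠ k)
    (hjl : j ≠ l) : ⁅tgenA N i j, tgenA N k l⁆ = 0 :=
  mk'_eq_zero_of_mem_tARel (Or.inr (Or.inr (Or.inr ⟨i, j, k, l, hik, hil, hjk, hjl, rfl⟩)))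

theorem lie_tgenA_add_eq_zero {i j : Fin N} (hij : i ≠ j) (k : Fin N) :
    ⁅tgenA N i j, tgenA N i k⁆ + ⁅tgenA N i j, tgenA N j k⁆ = 0 := by
  by_cases hik : i = k
  · subst hik
    simp [tgenA_comm j i]
  by_cases hjk : j = k
  · subst hjk
    simp
  rw [← lie_add, lie_tgenA_add hij hik hjk]

/-- A symmetric family vanishing on the diagonal extends to a linear map on `t_A(N)`. -/
theorem exists_linearMap_tgenA {V : Type*} [AddCommGroup V] [Module ℂ V] (w : Fin N → Fin N → V)
    (hsymm : ∀ i j, w i j = w j i) (hdiag : ∀ i, w i i = 0) :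
    ∃ g : tA N →ₗ[ℂ] V, ∀ i j, g (tgenA N i j) = w i j := by
  let _ : LieRing V :=
    { bracket := fun _ _ => 0
      add_lie := fun _ _ _ => (add_zero 0).symm
      lie_add := fun _ _ _ => (add_zero 0).symm
      lie_self := fun _ => rfl
      leibniz_lie := fun _ _ _ => (add_zero 0).symm }
  let _ : LieAlgebra ℂ V := { lie_smul := fun t _ _ => (smul_zero t).symm }
  have hlie : ∀ x y : V, ⁅x, y⁆ = 0 := fun _ _ => rfl
  obtain ⟨g, hg⟩ := exists_lift_quotient_lieSpan (I := tAIdeal N) rfl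
    (FreeLieAlgebra.lift ℂ fun p : Fin N × Fin N => w p.1 p.2) (by
      rintro x (⟨i, j, rfl⟩ | ⟨i, rfl⟩ | ⟨i, j, k, -, -, -, rfl⟩ | ⟨i, j, k, l, -, -, -, -, rfl⟩)
      · simp [FreeLieAlgebra.lift_of_apply, hsymm i j]
      · simp [FreeLieAlgebra.lift_of_apply, hdiag i]
      · rw [LieHom.map_lie, hlie]
      · rw [LieHom.map_lie, hlie])
  refine ⟨(g : tA N →ₗ[ℂ] V), fun i j => ?_⟩
  exact (hg _).trans (FreeLieAlgebra.lift_of_apply _ _)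

end tA

section sums

variable {ι M : Type*} [Fintype ι] [AddCommGroup M]

theorem Fintype.sum_eq_zero_of_pair {f : ι → M} {i j : ι} (hij : i ≠ j)
    (h : ∀ l, l ≠ i → l ≠ j → f l = 0) (hadd : f i + f j = 0) : ∑ l, f l = 0 := by
  classical
  rw [Fintype.sum_eq_add i j hij fun l hl => h l hl.1 hl.2, hadd]

theorem sum_ite_lt_eq_zero [LinearOrder ι] [Module ℂ M] {f : ι → ι → M}
    (hsymm : ∀ k l, f k l = f l k) (hdiag : ∀ k, f k k = 0) (hf : ∑ k, ∑ l, f k l = 0) :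
    ∑ k, ∑ l, (if k < l then f k l else 0) = 0 := by
  have h : ∑ k, ∑ l, f k l = (2 : ℂ) • ∑ k, ∑ l, (if k < l then f k l else 0) := by
    rw [two_smul]
    conv_rhs => rw [Finset.sum_comm]
    nth_rewrite 2 [Finset.sum_comm]
    rw [← Finset.sum_add_distrib]
    refine Finset.sum_congr rfl fun k _ => ?_
    rw [← Finset.sum_add_distrib]
    refine Finset.sum_congr rfl fun l _ => ?_
    rcases lt_trichotomy k l with h | rfl | h
    · simp [h, h.not_gt]
    · simp [hdiag]
    · simp [h, h.not_gt, hsymm k l]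
  rw [hf] at h
  exact (smul_eq_zero.1 h.symm).resolve_left two_ne_zero

end sums

section JucysMurphy

variable {N : ℕ}

/-- The Jucys–Murphy element `∑_{c < m} t_{cm}`. -/
def jucysMurphy (m : Fin N) : tA N := ∑ c, if c < m then tgenA N c m else 0

theorem lie_tgenA_jucysMurphy {a b m : Fin N} (hab : a ≠ b) (ha : a < m) (hb : b < m) :
    ⁅tgenA N a b, jucysMurphy m⁆ = 0 := by
  rw [jucysMurphy, lie_sum]
  refine Fintype.sum_eq_zero_of_pair hab (fun l hla hlb => ?_) ?_
  · split_ifs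
    · exact lie_tgenA_of_disjoint hla.symm ha.ne hlb.symm hb.ne
    · exact lie_zero _
  · rw [if_pos ha, if_pos hb]
    exact lie_tgenA_add_eq_zero hab m

theorem lie_jucysMurphy_of_lt {l m : Fin N} (h : l < m) :
    ⁅jucysMurphy l, jucysMurphy m⁆ = 0 := by
  rw [jucysMurphy, sum_lie]
  refine Finset.sum_eq_zero fun c _ => ?_
  split_ifs with hc
  · exact lie_tgenA_jucysMurphy hc.ne (hc.trans h) h
  · exact zero_lie _

theorem lie_jucysMurphy (l m : Fin N) : ⁅jucysMurphy l, jucysMurphy m⁆ = 0 := by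
  rcases lt_trichotomy l m with h | rfl | h
  · exact lie_jucysMurphy_of_lt h
  · exact lie_self _
  · rw [← lie_skew, lie_jucysMurphy_of_lt h, neg_zero]

theorem jucysMurphy_succ {n : ℕ} (l : Fin n) :
    jucysMurphy l.succ = tgenA (n + 1) 0 l.succ +
      ∑ c : Fin n, if c < l then tgenA (n + 1) c.succ l.succ else 0 := by
  rw [jucysMurphy, Fin.sum_univ_succ]
  simp

theorem JMsum_eq (n k : ℕ) :
    JMsum n k = ∑ l : Fin n, omegaA n k l • jucysMurphy l.succ := by
  rw [JMsum, Finset.sum_filter, Fintype.sum_prod_type_right, Fin.sum_univ_succ]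
  simp only [Fin.not_lt_zero, false_and, if_false, Finset.sum_const_zero, zero_add]
  refine Finset.sum_congr rfl fun l _ => ?_
  by_cases h : (l : ℕ) < k
  · simp [omegaA, h, jucysMurphy, Nat.succ_le_of_lt h]
  · have h' : ¬ (l : ℕ) + 1 ≤ k := by omega
    simp [omegaA, h, h']

/-- The symmetrized Jucys–Murphy element `t_{0l} + (1/2) ∑_{j ≥ 1} t_{lj}`. -/
def symmJucysMurphy {n : ℕ} (l : Fin n) : tA (n + 1) :=
  tgenA (n + 1) 0 l.succ + (2⁻¹ : ℂ) • ∑ j : Fin n, tgenA (n + 1) l.succ j.succ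

theorem lie_tgenA_symmJucysMurphy_of_ne {n : ℕ} {a b l : Fin n} (hab : a ≠ b) (hla : l ≠ a)
    (hlb : l ≠ b) : ⁅tgenA (n + 1) a.succ b.succ, symmJucysMurphy l⁆ = 0 := by
  have inj : ∀ {x y : Fin n}, x ≠ y → x.succ ≠ y.succ := fun h => (Fin.succ_injective n).ne h
  rw [symmJucysMurphy, lie_add, lie_smul, lie_sum, lie_tgenA_of_disjoint (Fin.succ_ne_zero _)
    (inj hla.symm) (Fin.succ_ne_zero _) (inj hlb.symm),
    Fintype.sum_eq_zero_of_pair hab, smul_zero, add_zero]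
  · exact fun j hja hjb => lie_tgenA_of_disjoint (inj hla.symm) (inj hja.symm) (inj hlb.symm)
      (inj hjb.symm)
  · rw [tgenA_comm l.succ a.succ, tgenA_comm l.succ b.succ]
    exact lie_tgenA_add_eq_zero (inj hab) _

theorem lie_tgenA_symmJucysMurphy_add {n : ℕ} {a b : Fin n} (hab : a ≠ b) :
    ⁅tgenA (n + 1) a.succ b.succ, symmJucysMurphy a⁆ +
      ⁅tgenA (n + 1) a.succ b.succ, symmJucysMurphy b⁆ = 0 := by
  have hab' : a.succ ≠ b.succ := (Fin.succ_injective n).ne hab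
  simp only [symmJucysMurphy, lie_add, lie_smul, lie_sum]
  rw [add_add_add_comm, ← smul_add, ← Finset.sum_add_distrib, tgenA_comm 0 a.succ,
    tgenA_comm 0 b.succ, lie_tgenA_add_eq_zero hab',
    Finset.sum_eq_zero fun j _ => lie_tgenA_add_eq_zero hab' _, smul_zero, add_zero]

end JucysMurphy

section trig

variable {n : ℕ}

theorem eps_apply (i : Fin n) (v : VA n) : eps n i v = v i := rfl

theorem eps_sub_eps_inj {i j k l : Fin n} (hij : i ≠ j)
    (h : eps n i - eps n j = eps n k - eps n l) : i = k ∧ j = l := by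
  have key : ∀ m : Fin n, ((if i = m then 1 else 0) - (if j = m then 1 else 0) : ℂ) =
      (if k = m then 1 else 0) - (if l = m then 1 else 0) := fun m => by
    simpa [eps_apply, Pi.single_apply] using LinearMap.congr_fun h (Pi.single m 1)
  have hi := key i
  have hj := key j
  simp only [hij, hij.symm, if_true, if_false] at hi hj
  constructor
  · by_contra hne
    rw [if_neg (Ne.symm hne)] at hi
    split_ifs at hi <;> norm_num at hi
  · by_contra hne
    rw [if_neg (Ne.symm hne)] at hj
    split_ifs at hj <;> norm_num at hj

theorem eps_sub_eps_mem {i j : Fin n} (h : i ≠ j) : eps n i - eps n j ∈ PhiA n := ⟨i, j, h, rfl⟩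

theorem zero_notMem_PhiA : (0 : Module.Dual ℂ (VA n)) ∉ PhiA n := by
  rintro ⟨i, j, hij, h⟩
  exact hij (eps_sub_eps_inj (k := i) (l := i) hij (by rw [← h, sub_self])).2.symm

theorem PhiAplus_eq_image :
    PhiAplus n = (fun p : Fin n × Fin n => eps n p.1 - eps n p.2) '' {p | p.1 < p.2} := by
  ext f
  constructor
  · rintro ⟨i, j, h, rfl⟩
    exact ⟨(i, j), h, rfl⟩
  · rintro ⟨p, h, rfl⟩
    exact ⟨p.1, p.2, h, rfl⟩

open Classical in
theorem finsum_mem_inter_PhiAplus {M : Type*} [AddCommMonoid M]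
    (Ψ : Set (Module.Dual ℂ (VA n))) (F : Module.Dual ℂ (VA n) → M) :
    ∑ᶠ β ∈ Ψ ∩ PhiAplus n, F β = ∑ k, ∑ l, if k < l then
      (if eps n k - eps n l ∈ Ψ then F (eps n k - eps n l) else 0) else 0 := by
  have himg : Ψ ∩ PhiAplus n = (fun p : Fin n × Fin n => eps n p.1 - eps n p.2) ''
      ((Finset.univ.filter fun p : Fin n × Fin n =>
        p.1 < p.2 ∧ eps n p.1 - eps n p.2 ∈ Ψ : Finset (Fin n × Fin n)) : Set (Fin n × Fin n)) := by
    rw [PhiAplus_eq_image]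
    ext f
    constructor
    · rintro ⟨hf, p, hp, rfl⟩
      exact ⟨p, by simpa using ⟨hp, hf⟩, rfl⟩
    · rintro ⟨p, hp, rfl⟩
      have hp' : p.1 < p.2 ∧ eps n p.1 - eps n p.2 ∈ Ψ := by simpa using hp
      exact ⟨hp'.2, p, hp'.1, rfl⟩
  rw [himg, finsum_mem_image, finsum_mem_coe_finset, Finset.sum_filter, Fintype.sum_prod_type]
  · simp only [ite_and]
  · intro p hp q _ h
    have hp' : p.1 < p.2 ∧ eps n p.1 - eps n p.2 ∈ Ψ := by simpa using hp
    exact Prod.ext_iff.2 (eps_sub_eps_inj hp'.1.ne h)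

/-- The images of the generators of `t_n^trig` in `t_A(n+1)`. -/
def psiGen (n : ℕ) : ↥(PhiA n) ⊕ VA n → tA (n + 1) :=
  Sum.elim (fun f => tgenA (n + 1) f.2.choose.succ f.2.choose_spec.choose.succ)
    fun v => -∑ l : Fin n, v l • jucysMurphy l.succ

/-- The homomorphism of the free Lie algebra on the generators of `t_n^trig`. -/
def psiFree (n : ℕ) : FTrigA n →ₗ⁅ℂ⁆ tA (n + 1) := FreeLieAlgebra.lift ℂ (psiGen n)

theorem psiFree_tgA {i j : Fin n} (hij : i ≠ j) :
    psiFree n (tgA n (eps n i - eps n j)) = tgenA (n + 1) i.succ j.succ := by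
  have hf := eps_sub_eps_mem hij
  rw [tgA, dif_pos hf, psiFree, FreeLieAlgebra.lift_of_apply]
  obtain ⟨h1, h2⟩ := eps_sub_eps_inj hij hf.choose_spec.choose_spec.2
  exact congrArg₂ (fun a b : Fin n => tgenA (n + 1) a.succ b.succ) h1.symm h2.symm

theorem psiFree_ttA (v : VA n) :
    psiFree n (ttA n v) = -∑ l : Fin n, v l • jucysMurphy l.succ := by
  rw [ttA, psiFree, FreeLieAlgebra.lift_of_apply]
  rfl

theorem psiFree_tdA (v : VA n) :
    psiFree n (tdA n v) = -∑ l : Fin n, v l • symmJucysMurphy l := by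
  have hsum : ∑ᶠ f ∈ PhiAplus n, f v • tgA n f =
      ∑ k, ∑ l, if k < l then (v k - v l) • tgA n (eps n k - eps n l) else 0 := by
    simpa [eps_apply] using finsum_mem_inter_PhiAplus Set.univ fun f => f v • tgA n f
  have hmap : psiFree n (∑ᶠ f ∈ PhiAplus n, f v • tgA n f) =
      ∑ k : Fin n, v k • ((∑ l : Fin n, if k < l then tgenA (n + 1) k.succ l.succ else 0) -
        ∑ l : Fin n, if l < k then tgenA (n + 1) l.succ k.succ else 0) := by
    have h : ∀ k l : Fin n, psiFree n (if k < l then (v k - v l) • tgA n (eps n k - eps n l)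
        else 0) = v k • (if k < l then tgenA (n + 1) k.succ l.succ else 0) -
          v l • (if k < l then tgenA (n + 1) k.succ l.succ else 0) := by
      intro k l
      split_ifs with hkl
      · rw [map_smul, psiFree_tgA hkl.ne, sub_smul]
      · simp
    simp only [hsum, map_sum, h, Finset.sum_sub_distrib, smul_sub, Finset.smul_sum]
    congr 1
    exact Finset.sum_comm
  rw [tdA, map_sub, map_smul, hmap, psiFree_ttA, Finset.smul_sum, ← Finset.sum_neg_distrib,
    ← Finset.sum_sub_distrib, ← Finset.sum_neg_distrib]
  refine Finset.sum_congr rfl fun l _ => ?_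
  have hsplit : ∑ j : Fin n, tgenA (n + 1) l.succ j.succ =
      (∑ j : Fin n, if l < j then tgenA (n + 1) l.succ j.succ else 0) +
        ∑ j : Fin n, if j < l then tgenA (n + 1) j.succ l.succ else 0 := by
    rw [← Finset.sum_add_distrib]
    refine Finset.sum_congr rfl fun j _ => ?_
    rcases lt_trichotomy l j with h | rfl | h
    · simp [h, h.not_gt]
    · simp
    · simp [h, h.not_gt, tgenA_comm l.succ j.succ]
  rw [jucysMurphy_succ, symmJucysMurphy, hsplit]
  module

open Classical in
theorem psiFree_rank_two_rel {Ψ : Set (Module.Dual ℂ (VA n))} (hneg : ∀ α ∈ Ψ, -α ∈ Ψ)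
    (hadd : ∀ α ∈ Ψ, ∀ β ∈ Ψ, α + β ∈ PhiA n → α + β ∈ Ψ) {i j : Fin n} (hij : i ≠ j)
    (hα : eps n i - eps n j ∈ Ψ) :
    ⁅tgenA (n + 1) i.succ j.succ, psiFree n (∑ᶠ β ∈ Ψ ∩ PhiAplus n, tgA n β)⁆ = 0 := by
  set f : Fin n → Fin n → tA (n + 1) := fun k l =>
    if eps n k - eps n l ∈ Ψ then ⁅tgenA (n + 1) i.succ j.succ, tgenA (n + 1) k.succ l.succ⁆
    else 0 with hf
  have hmem : ∀ k l, eps n k - eps n l ∈ Ψ ↔ eps n l - eps n k ∈ Ψ := fun k l =>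
    ⟨fun h => by simpa using hneg _ h, fun h => by simpa using hneg _ h⟩
  have hsymm : ∀ k l, f k l = f l k := fun k l => by
    simp only [hf, hmem k l, tgenA_comm k.succ l.succ]
  have hdiag : ∀ k, f k k = 0 := fun k => by simp [hf]
  have hrow : ∀ k, f i k + f j k = 0 := by
    intro k
    by_cases hik : i = k
    · subst hik
      simp [hf, tgenA_comm j.succ i.succ]
    by_cases hjk : j = k
    · subst hjk
      simp [hf]
    have hiff : eps n i - eps n k ∈ Ψ ↔ eps n j - eps n k ∈ Ψ := by
      constructor
      · intro h
        have := hadd _ ((hmem i j).1 hα) _ h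
        rw [sub_add_sub_cancel] at this
        exact this (eps_sub_eps_mem hjk)
      · intro h
        have := hadd _ hα _ h
        rw [sub_add_sub_cancel] at this
        exact this (eps_sub_eps_mem hik)
    simp only [hf, hiff]
    split_ifs
    · exact lie_tgenA_add_eq_zero ((Fin.succ_injective n).ne hij) _
    · exact add_zero 0
  have hzero : ∑ k, ∑ l, f k l = 0 := by
    refine Fintype.sum_eq_zero_of_pair hij (fun k hki hkj => ?_) ?_
    · refine Fintype.sum_eq_zero_of_pair hij (fun l hli hlj => ?_) ?_
      · simp only [hf]
        split_ifs
        · apply lie_tgenA_of_disjoint <;> apply (Fin.succ_injective n).ne <;>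
            first | exact hki.symm | exact hkj.symm | exact hli.symm | exact hlj.symm
        · rfl
      · rw [hsymm k i, hsymm k j, hrow]
    · rw [← Finset.sum_add_distrib]
      exact Finset.sum_eq_zero fun l _ => hrow l
  rw [← sum_ite_lt_eq_zero hsymm hdiag hzero, finsum_mem_inter_PhiAplus, map_sum, lie_sum]
  refine Finset.sum_congr rfl fun k _ => ?_
  rw [map_sum, lie_sum]
  refine Finset.sum_congr rfl fun l _ => ?_
  by_cases hkl : k < l
  · by_cases hmem : eps n k - eps n l ∈ Ψ
    · simp [hf, hkl, hmem, psiFree_tgA hkl.ne]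
    · simp [hf, hmem]
  · simp [hkl]

theorem psiFree_eq_zero_of_mem_trigARel {x : FTrigA n} (hx : x ∈ trigARel n) :
    psiFree n x = 0 := by
  rcases hx with ⟨_, ⟨i, j, hij, rfl⟩, rfl⟩ | ⟨c₁, c₂, h₁, h₂, rfl⟩ | ⟨h₁, h₂, rfl⟩ |
    ⟨Ψ, hΨ, hneg, -, hadd, α, hα, rfl⟩ | ⟨_, ⟨i, j, hij, rfl⟩, v, hv, rfl⟩
  · rw [map_sub, neg_sub, psiFree_tgA hij, psiFree_tgA hij.symm, tgenA_comm, sub_self]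
  · simp only [map_sub, map_smul, psiFree_ttA, Pi.add_apply, Pi.smul_apply, smul_eq_mul, add_smul,
      mul_smul, Finset.sum_add_distrib, Finset.smul_sum, smul_neg]
    abel
  · rw [LieHom.map_lie, psiFree_ttA, psiFree_ttA, neg_lie, lie_neg, neg_neg, sum_lie]
    refine Finset.sum_eq_zero fun l _ => ?_
    rw [lie_sum]
    refine Finset.sum_eq_zero fun m _ => ?_
    rw [smul_lie, lie_smul, lie_jucysMurphy, smul_zero, smul_zero]
  · obtain ⟨i, j, hij, rfl⟩ := hΨ hα
    rw [LieHom.map_lie, psiFree_tgA hij, psiFree_rank_two_rel hneg hadd hij hα]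
  · have hvij : v i = v j := sub_eq_zero.1 hv
    rw [LieHom.map_lie, psiFree_tgA hij, psiFree_tdA, lie_neg, lie_sum,
      Fintype.sum_eq_zero_of_pair hij, neg_zero]
    · intro l hli hlj
      rw [lie_smul, lie_tgenA_symmJucysMurphy_of_ne hij hli hlj, smul_zero]
    · rw [lie_smul, lie_smul, hvij, ← smul_add, lie_tgenA_symmJucysMurphy_add hij, smul_zero]

theorem mk'_eq_zero_of_mem_trigARel {x : FTrigA n} (hx : x ∈ trigARel n) :
    LieSubmodule.Quotient.mk' (trigAIdeal n) x = 0 :=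
  (LieSubmodule.Quotient.mk_eq_zero _).2 (LieSubmodule.subset_lieSpan hx)

theorem TijA_self (i : Fin n) : TijA n i i = 0 := by
  rw [TijA, sub_self, tgA, dif_neg zero_notMem_PhiA, map_zero]

theorem TijA_comm (i j : Fin n) : TijA n i j = TijA n j i := by
  by_cases hij : i = j
  · rw [hij]
  have h := mk'_eq_zero_of_mem_trigARel (n := n) (Or.inl ⟨_, eps_sub_eps_mem hij, rfl⟩)
  rw [map_sub, neg_sub] at h
  exact sub_eq_zero.1 h

theorem TauA_smul_add (c₁ c₂ : ℂ) (h₁ h₂ : VA n) :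
    TauA n (c₁ • h₁ + c₂ • h₂) = c₁ • TauA n h₁ + c₂ • TauA n h₂ := by
  have h := mk'_eq_zero_of_mem_trigARel (n := n) (Or.inr (Or.inl ⟨c₁, c₂, h₁, h₂, rfl⟩))
  rw [map_sub, map_sub, map_smul, map_smul, sub_sub] at h
  exact sub_eq_zero.1 h

theorem TauA_eq_sum (v : VA n) : TauA n v = ∑ l, v l • TauA n (Pi.single l 1) := by
  let τ : VA n →ₗ[ℂ] TrigA n :=
    { toFun := TauA n
      map_add' := fun x y => by simpa using TauA_smul_add 1 1 x y
      map_smul' := fun c x => by simpa using TauA_smul_add c 0 x 0 }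
  have h : τ v = ∑ l, v l • τ (Pi.single l 1) := by
    conv_lhs => rw [pi_eq_sum_univ' v]
    rw [map_sum]
    exact Finset.sum_congr rfl fun l _ => map_smul τ _ _
  exact h

/-- A linear retraction of `ψ` on the span of the generators of `t_n^trig`. -/
theorem exists_linearMap_tA_TrigA (n : ℕ) : ∃ r : tA (n + 1) →ₗ[ℂ] TrigA n,
    (∀ i j : Fin n, r (tgenA (n + 1) i.succ j.succ) = TijA n i j) ∧
    ∀ l : Fin n, r (jucysMurphy l.succ) = -TauA n (Pi.single l 1) := by
  let u : Fin n → TrigA n := fun l =>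
    -TauA n (Pi.single l 1) - ∑ c : Fin n, if c < l then TijA n c l else 0
  obtain ⟨r, hr⟩ := exists_linearMap_tgenA (N := n + 1)
    (Fin.cases (motive := fun _ => Fin (n + 1) → TrigA n)
      (Fin.cases (motive := fun _ => TrigA n) 0 u)
      fun i => Fin.cases (motive := fun _ => TrigA n) (u i) (TijA n i))
    (by
      intro i j
      induction i using Fin.cases <;> induction j using Fin.cases <;>
        first | rfl | exact TijA_comm _ _)
    (by
      intro i
      induction i using Fin.cases <;> first | rfl | exact TijA_self _)
  have hr' : ∀ i j : Fin n, r (tgenA (n + 1) i.succ j.succ) = TijA n i j := fun i j =>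
    hr i.succ j.succ
  refine ⟨r, hr', fun l => ?_⟩
  rw [jucysMurphy_succ, map_add, map_sum, hr]
  have hite : ∀ c : Fin n, r (if c < l then tgenA (n + 1) c.succ l.succ else 0) =
      if c < l then TijA n c l else 0 := fun c => by
    split_ifs
    · exact hr' c l
    · exact map_zero r
  simp [hite, u]

end trig

/-- There is a Lie algebra homomorphism `ψ : t_n^trig → t_A(n+1)` with
`ψ(t_{ij}) = t_{ij}` for `1 ≤ i < j ≤ n` and
`ψ(τ(ω_k)) = -∑_{l=1}^{k} ∑_{c=0}^{l-1} t_{cl}` for `k = 1, …, n` (the indices of `t_n^trig`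
being shifted by one inside `{0, 1, …, n}`). Moreover, `ψ` is injective on the span of the
generators `t_{ij}` (`1 ≤ i < j ≤ n`) and `τ(h)` (`h ∈ ℂⁿ`). -/
theorem trig_to_tA_hom (n : ℕ) :
    ∃ ψ : TrigA n →ₗ⁅ℂ⁆ tA (n + 1),
      (∀ i j : Fin n, i < j → ψ (TijA n i j) = tgenA (n + 1) i.succ j.succ) ∧
      (∀ k : ℕ, 1 ≤ k → k ≤ n → ψ (TauA n (omegaA n k)) = -JMsum n k) ∧
      Set.InjOn ψ
        ((Submodule.span ℂ
          ({x | ∃ i j : Fin n, i < j ∧ x = TijA n i j} ∪ Set.range (TauA n)) :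
            Submodule ℂ (TrigA n)) : Set (TrigA n)) := by
  obtain ⟨ψ, hψ⟩ := exists_lift_quotient_lieSpan (I := trigAIdeal n) rfl (psiFree n)
    fun _ => psiFree_eq_zero_of_mem_trigARel
  have hT : ∀ i j : Fin n, i < j → ψ (TijA n i j) = tgenA (n + 1) i.succ j.succ :=
    fun i j hij => (hψ _).trans (psiFree_tgA hij.ne)
  have hτ : ∀ v : VA n, ψ (TauA n v) = -∑ l : Fin n, v l • jucysMurphy l.succ :=
    fun v => (hψ _).trans (psiFree_ttA v)
  refine ⟨ψ, hT, fun k _ _ => by rw [hτ, JMsum_eq], ?_⟩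
  obtain ⟨r, hrT, hrJ⟩ := exists_linearMap_tA_TrigA n
  have hleft : Set.LeftInvOn r ψ (Submodule.span ℂ
      ({x | ∃ i j : Fin n, i < j ∧ x = TijA n i j} ∪ Set.range (TauA n)) :
        Submodule ℂ (TrigA n)) := by
    refine LinearMap.eqOn_span (f := r ∘ₗ (ψ : TrigA n →ₗ[ℂ] tA (n + 1))) (g := LinearMap.id) ?_
    rintro x (⟨i, j, hij, rfl⟩ | ⟨v, rfl⟩)
    · change r (ψ (TijA n i j)) = TijA n i j
      rw [hT i j hij, hrT]
    · change r (ψ (TauA n v)) = TauA n v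
      rw [hτ, map_neg, map_sum, TauA_eq_sum v, ← Finset.sum_neg_distrib]
      refine Finset.sum_congr rfl fun l _ => ?_
      rw [map_smul, hrJ, smul_neg, neg_neg]
  exact hleft.injOn

end
end
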